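/- For every constant C > 0 there exists a constant K = K(C) > 0 such that for all n ≥ 2, P(det(M_n) = 0 and rank(M_{n−1}) = n−2) ≤ K · n^{−C}, where M_{n−1} denotes the principal (n−1)×(n−1) submatrix of M_n obtained by deleting the first row and the first column. -/

import Mathlib

open scoped Classical BigOperators

noncomputable section

/-- The real number (±1) corresponding to a Boolean sign bit. -/
def signv (b : Bool) : ℝ := if b then 1 else -1

/-- The random symmetric Bernoulli (±1) matrix. -/
def symMat (n : ℕ) (g : Fin n → Fin n → Bool) : Matrix (Fin n) (Fin n) ℝ :=
  Matrix.of fun i j => if i ≤ j then signv (g i j) else signv (g j i)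

/-- Probability of an event for the random symmetric Bernoulli matrix. -/
def probSym (n : ℕ) (p : Matrix (Fin n) (Fin n) ℝ → Prop) : ℝ :=
  ((Finset.univ.filter fun g : Fin n → Fin n → Bool => p (symMat n g)).card : ℝ) /
    (Fintype.card (Fin n → Fin n → Bool) : ℝ)

section CircleNorm

variable {p : ℕ} [Fact p.Prime]

/-- The square of `sin (2πx/p)`. -/
def sinSq (x : ZMod p) : ℝ := (ZMod.stdAddChar x).im ^ 2

lemma re_sq_add_sinSq (x : ZMod p) : (ZMod.stdAddChar x).re ^ 2 + sinSq x = 1 := by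
  have h := AddChar.norm_apply (ZMod.stdAddChar (N := p)) x
  have h2 : ‖ZMod.stdAddChar x‖ ^ 2 = 1 := by rw [h]; norm_num
  rw [← Complex.normSq_eq_norm_sq, Complex.normSq_apply] at h2
  unfold sinSq
  linarith

lemma sinSq_nonneg (x : ZMod p) : 0 ≤ sinSq x := sq_nonneg _

lemma sinSq_le_one (x : ZMod p) : sinSq x ≤ 1 := by
  nlinarith [re_sq_add_sinSq x, sq_nonneg (ZMod.stdAddChar x).re]

lemma sinSq_zero : sinSq (0 : ZMod p) = 0 := by simp [sinSq]

lemma sinSq_add_le (x y : ZMod p) : sinSq (x + y) ≤ 2 * sinSq x + 2 * sinSq y := by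
  have hx := re_sq_add_sinSq x
  have hy := re_sq_add_sinSq y
  unfold sinSq at *
  rw [AddChar.map_add_eq_mul, Complex.mul_im]
  set a := (ZMod.stdAddChar x).re
  set b := (ZMod.stdAddChar x).im
  set c := (ZMod.stdAddChar y).re
  set d := (ZMod.stdAddChar y).im
  nlinarith [sq_nonneg (a * d - b * c), mul_nonneg (sq_nonneg d) (sq_nonneg b)]

lemma re_two_mul (x : ZMod p) : (ZMod.stdAddChar (2 * x)).re = 1 - 2 * sinSq x := by
  have hx := re_sq_add_sinSq x
  unfold sinSq at *
  rw [two_mul, AddChar.map_add_eq_mul, Complex.mul_re]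
  linarith

lemma abs_re_le_exp (x : ZMod p) :
    |(ZMod.stdAddChar x).re| ≤ Real.exp (-(sinSq x / 2)) := by
  refine abs_le_of_sq_le_sq ?_ (Real.exp_pos _).le
  rw [← Real.exp_nat_mul]
  have := Real.add_one_le_exp (-sinSq x)
  have h2 := re_sq_add_sinSq x
  have : ((2 : ℕ) : ℝ) * -(sinSq x / 2) = -sinSq x := by push_cast; ring
  rw [this]
  linarith

lemma sum_stdAddChar_mul (b : ZMod p) :
    ∑ t : ZMod p, ZMod.stdAddChar (t * b) = if b = 0 then (p : ℂ) else 0 := by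
  have := AddChar.sum_mulShift b (ZMod.isPrimitive_stdAddChar p)
  rw [this, ZMod.card]
  split_ifs <;> simp

lemma exists_half_le_sinSq (hp : p ≠ 2) : ∃ x : ZMod p, 1 / 2 ≤ sinSq x := by
  by_contra! h
  have h2 : (2 : ZMod p) ≠ 0 := by
    have := (ZMod.prime_ne_zero p 2 (by exact_mod_cast hp))
    exact_mod_cast this
  have hs := congrArg Complex.re (sum_stdAddChar_mul (p := p) 2)
  rw [if_neg h2, Complex.re_sum, Complex.zero_re] at hs
  have : 0 < ∑ t : ZMod p, (ZMod.stdAddChar (t * 2)).re := by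
    apply Finset.sum_pos
    · intro t _
      rw [mul_comm, re_two_mul]
      linarith [h t]
    · exact ⟨0, Finset.mem_univ _⟩
  linarith

end CircleNorm

section Weights

variable {p : ℕ} [Fact p.Prime] {ι : Type*}

/-- A majorant of the square root of the modulus of the characteristic function at `t` of the
random signed sum of the `a j`, `j ∈ J`. -/
def charWeight (J : Finset ι) (a : ι → ZMod p) (t : ZMod p) : ℝ :=
  Real.exp (-((∑ j ∈ J, sinSq (t * a j)) / 4))

/-- The total mass of the weight. -/
def weightMass (J : Finset ι) (a : ι → ZMod p) : ℝ := ∑ t, charWeight J a t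

/-- The total mass of the squared weight. -/
def weightEnergy (J : Finset ι) (a : ι → ZMod p) : ℝ := ∑ t, charWeight J a t ^ 2

lemma charWeight_pos (J : Finset ι) (a : ι → ZMod p) (t : ZMod p) : 0 < charWeight J a t :=
  Real.exp_pos _

lemma charWeight_le_one (J : Finset ι) (a : ι → ZMod p) (t : ZMod p) :
    charWeight J a t ≤ 1 := by
  unfold charWeight
  rw [Real.exp_le_one_iff]
  have : 0 ≤ ∑ j ∈ J, sinSq (t * a j) := Finset.sum_nonneg fun j _ => sinSq_nonneg _
  linarith

lemma charWeight_zero (J : Finset ι) (a : ι → ZMod p) : charWeight J a 0 = 1 := by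
  simp [charWeight, sinSq_zero]

lemma charWeight_add (J : Finset ι) (a : ι → ZMod p) (s t : ZMod p) :
    charWeight J a s ^ 2 * charWeight J a t ^ 2 ≤ charWeight J a (s + t) := by
  unfold charWeight
  rw [← Real.exp_nat_mul, ← Real.exp_nat_mul, ← Real.exp_add, Real.exp_le_exp]
  have : ∑ j ∈ J, sinSq ((s + t) * a j) ≤
      ∑ j ∈ J, (2 * sinSq (s * a j) + 2 * sinSq (t * a j)) :=
    Finset.sum_le_sum fun j _ => by rw [add_mul]; exact sinSq_add_le _ _
  rw [Finset.sum_add_distrib, ← Finset.mul_sum, ← Finset.mul_sum] at this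
  push_cast
  linarith

lemma charWeight_insert [DecidableEq ι] {J : Finset ι} {i : ι} (hi : i ∉ J)
    (a : ι → ZMod p) (t : ZMod p) :
    charWeight (insert i J) a t = charWeight J a t * Real.exp (-(sinSq (t * a i) / 4)) := by
  unfold charWeight
  rw [Finset.sum_insert hi, ← Real.exp_add]
  congr 1
  ring

lemma charWeight_anti {I J : Finset ι} (h : I ⊆ J) (a : ι → ZMod p) (t : ZMod p) :
    charWeight J a t ≤ charWeight I a t := by
  unfold charWeight
  rw [Real.exp_le_exp]
  have := Finset.sum_le_sum_of_subset_of_nonneg h (f := fun j => sinSq (t * a j))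
    fun j _ _ => sinSq_nonneg _
  linarith

lemma charWeight_congr {J : Finset ι} {a b : ι → ZMod p} (h : ∀ j ∈ J, a j = b j) :
    charWeight J a = charWeight J b := by
  funext t
  unfold charWeight
  rw [Finset.sum_congr rfl fun j hj => by rw [h j hj]]

lemma weightMass_anti {I J : Finset ι} (h : I ⊆ J) (a : ι → ZMod p) :
    weightMass J a ≤ weightMass I a :=
  Finset.sum_le_sum fun t _ => charWeight_anti h a t

lemma one_le_weightMass (J : Finset ι) (a : ι → ZMod p) : 1 ≤ weightMass J a := by
  rw [← charWeight_zero J a]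
  exact Finset.single_le_sum (f := charWeight J a) (fun t _ => (charWeight_pos J a t).le)
    (Finset.mem_univ 0)

lemma weightMass_le (J : Finset ι) (a : ι → ZMod p) : weightMass J a ≤ p := by
  calc weightMass J a ≤ ∑ _t : ZMod p, (1 : ℝ) :=
        Finset.sum_le_sum fun t _ => charWeight_le_one J a t
    _ = p := by simp

lemma weightEnergy_nonneg (J : Finset ι) (a : ι → ZMod p) : 0 ≤ weightEnergy J a :=
  Finset.sum_nonneg fun _ _ => sq_nonneg _

lemma weightEnergy_le_weightMass (J : Finset ι) (a : ι → ZMod p) :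
    weightEnergy J a ≤ weightMass J a :=
  Finset.sum_le_sum fun t _ => by
    nlinarith [charWeight_pos J a t, charWeight_le_one J a t]

open scoped Pointwise in
/-- The weight cannot concentrate on points where it is close to `1`, since the set of such
points has small doubling while every proper subset of `ZMod p` satisfies the Cauchy–Davenport
inequality. -/
lemma weightEnergy_le (hp : p ≠ 2) {J : Finset ι} {a : ι → ZMod p} {i : ι} (hi : i ∈ J)
    (ha : a i ≠ 0) (hU : 2 ≤ weightMass J a) :
    weightEnergy J a ≤ 0.997 * weightMass J a := by
  by_contra! hQ
  set u := charWeight J a with hu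
  have hu0 : ∀ t, 0 < u t := charWeight_pos J a
  have hu1 : ∀ t, u t ≤ 1 := charWeight_le_one J a
  set A : Finset (ZMod p) := Finset.univ.filter fun t => 0.97 ≤ u t with hA
  set B : Finset (ZMod p) := Finset.univ.filter fun t => 0.97 ^ 4 ≤ u t with hB
  have hsplit : ∑ t ∈ A, u t + ∑ t ∈ Finset.univ.filter (fun t => ¬ 0.97 ≤ u t), u t =
      weightMass J a := Finset.sum_filter_add_sum_filter_not _ _ _
  have hout : 0.03 * ∑ t ∈ Finset.univ.filter (fun t => ¬ 0.97 ≤ u t), u t ≤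
      weightMass J a - weightEnergy J a := by
    unfold weightMass weightEnergy
    rw [← Finset.sum_sub_distrib, Finset.mul_sum]
    refine (Finset.sum_le_sum fun t ht => ?_).trans
      (Finset.sum_le_sum_of_subset_of_nonneg (Finset.subset_univ _) fun t _ _ => ?_)
    · have h := (Finset.mem_filter.1 ht).2
      rw [not_le] at h
      change 0.03 * u t ≤ u t - u t ^ 2
      nlinarith [hu0 t]
    · change 0 ≤ u t - u t ^ 2
      nlinarith [hu0 t, hu1 t]
  have hAcard : ∑ t ∈ A, u t ≤ (A.card : ℝ) := by
    calc ∑ t ∈ A, u t ≤ ∑ _t ∈ A, (1 : ℝ) := Finset.sum_le_sum fun t _ => hu1 t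
      _ = A.card := by simp
  have hBcard : 0.97 ^ 4 * (B.card : ℝ) ≤ weightMass J a := by
    calc 0.97 ^ 4 * (B.card : ℝ) = ∑ _t ∈ B, (0.97 ^ 4 : ℝ) := by simp [mul_comm]
      _ ≤ ∑ t ∈ B, u t := Finset.sum_le_sum fun t ht => (Finset.mem_filter.1 ht).2
      _ ≤ weightMass J a :=
        Finset.sum_le_sum_of_subset_of_nonneg (Finset.subset_univ _) fun t _ _ => (hu0 t).le
  have hAne : A.Nonempty := by
    refine ⟨0, Finset.mem_filter.2 ⟨Finset.mem_univ _, ?_⟩⟩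
    rw [hu, charWeight_zero]
    norm_num
  have hAB : A + A ⊆ B := by
    intro x hx
    obtain ⟨s, hs, t, ht, rfl⟩ := Finset.mem_add.1 hx
    have hs := (Finset.mem_filter.1 hs).2
    have ht := (Finset.mem_filter.1 ht).2
    refine Finset.mem_filter.2 ⟨Finset.mem_univ _, le_trans ?_ (charWeight_add J a s t)⟩
    calc (0.97 : ℝ) ^ 4 = 0.97 ^ 2 * 0.97 ^ 2 := by norm_num
      _ ≤ u s ^ 2 * u t ^ 2 := by gcongr
  have hBlt : B.card < p := by
    obtain ⟨x, hx⟩ := exists_half_le_sinSq (p := p) hp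
    have : B ⊂ Finset.univ := by
      refine Finset.ssubset_univ_iff.2 fun h => ?_
      have hmem : x / a i ∈ B := h ▸ Finset.mem_univ _
      have h1 := (Finset.mem_filter.1 hmem).2
      have h2 : u (x / a i) ≤ charWeight {i} a (x / a i) :=
        charWeight_anti (Finset.singleton_subset_iff.2 hi) a _
      have h3 : charWeight {i} a (x / a i) ≤ Real.exp (-(1 / 8)) := by
        unfold charWeight
        rw [Finset.sum_singleton, div_mul_cancel₀ _ ha, Real.exp_le_exp]
        linarith
      have h4 : Real.exp (-(1 / 8)) < 0.97 ^ 4 := by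
        rw [Real.exp_neg]
        have h5 := Real.quadratic_le_exp_of_nonneg (x := 1 / 8) (by norm_num)
        rw [inv_lt_comm₀ (Real.exp_pos _) (by norm_num)]
        refine lt_of_lt_of_le ?_ h5
        norm_num
      linarith
    simpa using Finset.card_lt_card this
  have hCD := ZMod.cauchy_davenport (Fact.out : p.Prime) hAne hAne
  have hle := Finset.card_le_card hAB
  have h1 : A.card + A.card - 1 ≤ B.card := by
    rcases min_le_iff.1 (hCD.trans hle) with h | h
    · omega
    · exact h
  have h2 : (A.card : ℝ) + A.card ≤ B.card + 1 := by
    exact_mod_cast (by omega : A.card + A.card ≤ B.card + 1)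
  have h3 : 2 ≤ A.card := by
    have : (1 : ℝ) < A.card := by linarith
    exact_mod_cast this
  have h4 : (2 : ℝ) ≤ A.card := by exact_mod_cast h3
  norm_num at hBcard
  linarith

/-- The large spectrum of the weight. -/
def largeSpectrum (J : Finset ι) (a : ι → ZMod p) : Finset (ZMod p) :=
  Finset.univ.filter fun x =>
    0.999 * weightMass J a ≤ ∑ t, charWeight J a t * (1 - 2 * sinSq (t * x))

lemma sum_normSq_transform (hp : p ≠ 2) (u : ZMod p → ℝ) :
    ∑ x : ZMod p, ‖∑ t, (u t : ℂ) * ZMod.stdAddChar (2 * (t * x))‖ ^ 2 = p * ∑ t, u t ^ 2 := by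
  have h2 : (2 : ZMod p) ≠ 0 := by
    have := (ZMod.prime_ne_zero p 2 (by exact_mod_cast hp))
    exact_mod_cast this
  apply Complex.ofReal_injective
  push_cast
  simp_rw [← Complex.mul_conj', map_sum, map_mul, Complex.conj_ofReal,
    ← AddChar.map_neg_eq_conj, Finset.sum_mul_sum]
  rw [Finset.sum_comm, Finset.mul_sum]
  refine Finset.sum_congr rfl fun s _ => ?_
  rw [Finset.sum_comm, Finset.sum_eq_single s]
  · have : ∀ x : ZMod p, (u s : ℂ) * ZMod.stdAddChar (2 * (s * x)) *
        (u s * ZMod.stdAddChar (-(2 * (s * x)))) = (u s : ℂ) ^ 2 := by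
      intro x
      have h : ZMod.stdAddChar (2 * (s * x)) * ZMod.stdAddChar (-(2 * (s * x))) = (1 : ℂ) := by
        rw [← AddChar.map_add_eq_mul]; simp
      linear_combination (u s : ℂ) ^ 2 * h
    simp [this]
  · intro t _ hts
    have : ∀ x : ZMod p, (u s : ℂ) * ZMod.stdAddChar (2 * (s * x)) *
        (u t * ZMod.stdAddChar (-(2 * (t * x)))) =
        (u s : ℂ) * u t * ZMod.stdAddChar (x * (2 * (s - t))) := by
      intro x
      have h : x * (2 * (s - t)) = 2 * (s * x) + -(2 * (t * x)) := by ring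
      rw [h, AddChar.map_add_eq_mul]
      ring
    simp_rw [this]
    rw [← Finset.mul_sum, sum_stdAddChar_mul, if_neg, mul_zero]
    exact mul_ne_zero h2 (sub_ne_zero.2 (Ne.symm hts))
  · simp

lemma card_largeSpectrum_le (hp : p ≠ 2) (J : Finset ι) (a : ι → ZMod p) :
    ((largeSpectrum J a).card : ℝ) * (0.999 * weightMass J a) ^ 2 ≤ p * weightEnergy J a := by
  unfold weightEnergy
  rw [← sum_normSq_transform hp, ← nsmul_eq_mul, ← Finset.sum_const]
  refine (Finset.sum_le_sum fun x hx => ?_).trans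
    (Finset.sum_le_sum_of_subset_of_nonneg (Finset.subset_univ _) fun t _ _ => sq_nonneg _)
  have hx := (Finset.mem_filter.1 hx).2
  have h1 := one_le_weightMass J a
  refine pow_le_pow_left₀ (by linarith) (hx.trans ?_) 2
  refine le_trans (le_of_eq ?_) (Complex.re_le_norm _)
  rw [Complex.re_sum]
  refine Finset.sum_congr rfl fun t _ => ?_
  rw [Complex.re_ofReal_mul, re_two_mul]

/-- Every vector has a small set of coordinates, containing any prescribed one, whose large
spectrum contains all other coordinates. -/
lemma exists_core [Fintype ι] [DecidableEq ι] (a : ι → ZMod p) (i : ι) :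
    ∃ J : Finset ι, i ∈ J ∧ (16000 / 15999 : ℝ) ^ J.card ≤ 16000 / 15999 * p ∧
      ∀ j ∉ J, a j ∈ largeSpectrum J a := by
  set l : ℝ := 16000 / 15999 with hl
  have hl0 : 0 < l := by norm_num [hl]
  obtain ⟨J, hJ, hmin⟩ := Finset.exists_min_image
    (Finset.univ.filter fun J : Finset ι => i ∈ J)
    (fun J => weightMass J a * l ^ J.card) ⟨{i}, by simp⟩
  have hiJ := (Finset.mem_filter.1 hJ).2
  refine ⟨J, hiJ, ?_, fun j hj => ?_⟩
  · have h := hmin {i} (by simp)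
    simp only [Finset.card_singleton, pow_one] at h
    have h1 := one_le_weightMass J a
    have h2 := weightMass_le {i} a
    calc l ^ J.card ≤ weightMass J a * l ^ J.card := le_mul_of_one_le_left (by positivity) h1
      _ ≤ _ := h
      _ ≤ l * p := by rw [mul_comm]; gcongr
  · have h := hmin (insert j J) (by simp [hiJ])
    rw [Finset.card_insert_of_notMem hj, pow_succ, mul_comm _ l, ← mul_assoc] at h
    have h1 : weightMass J a ≤ weightMass (insert j J) a * l :=
      le_of_mul_le_mul_right h (by positivity)
    have h2 : weightMass (insert j J) a ≤
        ∑ t, (charWeight J a t - charWeight J a t * sinSq (t * a j) / 8) := by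
      refine Finset.sum_le_sum fun t _ => ?_
      rw [charWeight_insert hj]
      have h3 : Real.exp (-(sinSq (t * a j) / 4)) ≤ 1 - sinSq (t * a j) / 8 := by
        have h0 := sinSq_nonneg (t * a j)
        have h1 := sinSq_le_one (t * a j)
        have h4 := Real.add_one_le_exp (sinSq (t * a j) / 4)
        rw [Real.exp_neg]
        refine inv_le_of_inv_le₀ (by linarith) ?_
        refine le_trans ?_ h4
        rw [inv_le_iff_one_le_mul₀ (by linarith)]
        nlinarith
      have := mul_le_mul_of_nonneg_left h3 (charWeight_pos J a t).le
      linarith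
    rw [Finset.sum_sub_distrib, ← Finset.sum_div] at h2
    refine Finset.mem_filter.2 ⟨Finset.mem_univ _, ?_⟩
    have h3 : ∑ t, charWeight J a t * (1 - 2 * sinSq (t * a j)) =
        weightMass J a - 2 * ∑ t, charWeight J a t * sinSq (t * a j) := by
      unfold weightMass
      rw [Finset.mul_sum, ← Finset.sum_sub_distrib]
      exact Finset.sum_congr rfl fun t _ => by ring
    rw [h3]
    change weightMass (insert j J) a ≤ weightMass J a - _ at h2
    rw [hl] at h1
    linarith

end Weights

section Resampling

variable {κ : Type*} [Fintype κ] [DecidableEq κ]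

/-- Simultaneous exchange of the coordinates outside `B` preserves the uniform distribution on
pairs of configurations. -/
lemma sum_sum_piecewise (B : Finset κ) (F : (κ → Bool) → ℝ) :
    ∑ ω : κ → Bool, ∑ r : κ → Bool, F (B.piecewise r ω) =
      Fintype.card (κ → Bool) * ∑ ω, F ω := by
  let e : ((κ → Bool) × (κ → Bool)) ≃ ((κ → Bool) × (κ → Bool)) :=
    { toFun := fun x => (B.piecewise x.2 x.1, B.piecewise x.1 x.2)
      invFun := fun x => (B.piecewise x.2 x.1, B.piecewise x.1 x.2)
      left_inv := fun x => by
        ext k <;> by_cases hk : k ∈ B <;> simp [hk]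
      right_inv := fun x => by
        ext k <;> by_cases hk : k ∈ B <;> simp [hk] }
  rw [← Fintype.sum_prod_type' fun ω r => F (B.piecewise r ω),
    Fintype.sum_equiv e (fun x => F (B.piecewise x.2 x.1)) (fun x => F x.1) fun x => rfl,
    Fintype.sum_prod_type, Finset.mul_sum]
  simp

lemma card_and_le_of_resample (B : Finset κ) {E R : (κ → Bool) → Prop} [DecidablePred E]
    [DecidablePred R] {q : ℝ}
    (hE : ∀ ω, R ω → ((Finset.univ.filter fun r => E (B.piecewise r ω)).card : ℝ) ≤
      q * Fintype.card (κ → Bool))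
    (hR : ∀ ω r, R (B.piecewise r ω) ↔ R ω) :
    ((Finset.univ.filter fun ω => E ω ∧ R ω).card : ℝ) ≤
      q * (Finset.univ.filter fun ω => R ω).card := by
  have hc : (0 : ℝ) < Fintype.card (κ → Bool) := by exact_mod_cast Fintype.card_pos
  refine le_of_mul_le_mul_left ?_ hc
  have h := sum_sum_piecewise B fun ω => if E ω ∧ R ω then 1 else 0
  rw [Finset.sum_boole] at h
  rw [← h]
  calc ∑ ω : κ → Bool, ∑ r : κ → Bool,
        (if E (B.piecewise r ω) ∧ R (B.piecewise r ω) then (1 : ℝ) else 0)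
      ≤ ∑ ω : κ → Bool, (if R ω then q * Fintype.card (κ → Bool) else 0) := by
        refine Finset.sum_le_sum fun ω _ => ?_
        simp_rw [hR]
        by_cases hω : R ω
        · simpa [hω] using hE ω hω
        · simp [hω]
    _ = _ := by
        rw [← Finset.sum_filter, Finset.sum_const, nsmul_eq_mul]
        ring

lemma card_forall_le_of_resample {ι : Type*} [DecidableEq ι] (I : Finset ι) (B : ι → Finset κ)
    {E : ι → (κ → Bool) → Prop} {q : ℝ} (hq : 0 ≤ q)
    (hE : ∀ i ∈ I, ∀ ω, ((Finset.univ.filter fun r => E i ((B i).piecewise r ω)).card : ℝ) ≤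
      q * Fintype.card (κ → Bool))
    (hR : ∀ i ∈ I, ∀ j ∈ I, j ≠ i → ∀ ω r, E j ((B i).piecewise r ω) ↔ E j ω) :
    ((Finset.univ.filter fun ω => ∀ i ∈ I, E i ω).card : ℝ) ≤
      q ^ I.card * Fintype.card (κ → Bool) := by
  induction I using Finset.induction_on with
  | empty => simp
  | insert i I hi ih =>
    have ih := ih (fun j hj => hE j (Finset.mem_insert_of_mem hj)) fun j hj k hk =>
      hR j (Finset.mem_insert_of_mem hj) k (Finset.mem_insert_of_mem hk)
    have h := card_and_le_of_resample (B i) (E := E i) (R := fun ω => ∀ j ∈ I, E j ω)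
      (fun ω _ => hE i (Finset.mem_insert_self _ _) ω) fun ω r => by
        refine forall₂_congr fun j hj => hR i (Finset.mem_insert_self _ _) j
          (Finset.mem_insert_of_mem hj) ?_ ω r
        rintro rfl
        exact hi hj
    rw [Finset.card_insert_of_notMem hi, pow_succ', mul_assoc]
    refine (le_trans (le_of_eq ?_) h).trans
      (mul_le_mul_of_nonneg_left (le_trans (le_of_eq ?_) ih) hq)
    · congr 2
      ext ω
      simp only [Finset.mem_filter, Finset.mem_univ, true_and, Finset.forall_mem_insert]
    · congr

end Resampling

section SmallBall

/-- The integer sign of a Boolean. -/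
def intSign (b : Bool) : ℤ := if b then 1 else -1

lemma intSign_not (b : Bool) : intSign (!b) = -intSign b := by cases b <;> simp [intSign]

variable {p : ℕ} [Fact p.Prime] {ι κ : Type*} [DecidableEq ι] [Fintype κ] [DecidableEq κ]

lemma sum_stdAddChar_signed (t : ZMod p) (a : ι → ZMod p) {e : ι → κ} (J : Finset ι)
    (he : Set.InjOn e J) :
    ∑ ω : κ → Bool, ZMod.stdAddChar (t * ∑ j ∈ J, (intSign (ω (e j)) : ZMod p) * a j) =
      Fintype.card (κ → Bool) * ∏ j ∈ J, ((ZMod.stdAddChar (t * a j)).re : ℂ) := by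
  induction J using Finset.induction_on with
  | empty => simp
  | insert i J hi ih =>
    have ih := ih (he.mono (by simp))
    have hne : ∀ j ∈ J, e j ≠ e i := by
      intro j hj h
      have := he (by simp [hj]) (by simp) h
      exact hi (this ▸ hj)
    set P : (κ → Bool) → ℂ :=
      fun ω => ZMod.stdAddChar (t * ∑ j ∈ J, (intSign (ω (e j)) : ZMod p) * a j) with hP
    let f : (κ → Bool) ≃ (κ → Bool) :=
      { toFun := fun ω => Function.update ω (e i) (!ω (e i))
        invFun := fun ω => Function.update ω (e i) (!ω (e i))
        left_inv := fun ω => by simp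
        right_inv := fun ω => by simp }
    set F : (κ → Bool) → ℂ := fun ω =>
      ZMod.stdAddChar (t * ((intSign (ω (e i)) : ZMod p) * a i)) * P ω with hF
    have hsum : ∀ ω : κ → Bool, ZMod.stdAddChar
        (t * ∑ j ∈ insert i J, (intSign (ω (e j)) : ZMod p) * a j) = F ω := by
      intro ω
      rw [Finset.sum_insert hi, mul_add, AddChar.map_add_eq_mul]
    have hflip : ∀ ω, F ω + F (f ω) = 2 * ((ZMod.stdAddChar (t * a i)).re * P ω) := by
      intro ω
      have h1 : P (f ω) = P ω := by
        simp only [hP]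
        congr 2
        refine Finset.sum_congr rfl fun j hj => ?_
        simp [f, hne j hj]
      have h2 : ZMod.stdAddChar (t * ((intSign (f ω (e i)) : ZMod p) * a i)) =
          (starRingEnd ℂ) (ZMod.stdAddChar (t * ((intSign (ω (e i)) : ZMod p) * a i))) := by
        rw [← AddChar.map_neg_eq_conj]
        congr 1
        simp [f, intSign_not]
      have h3 : (ZMod.stdAddChar (t * ((intSign (ω (e i)) : ZMod p) * a i))).re =
          (ZMod.stdAddChar (t * a i)).re := by
        cases ω (e i)
        · simp [intSign, AddChar.map_neg_eq_conj]
        · simp [intSign]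
      simp only [hF]
      rw [h1, h2, ← add_mul, Complex.add_conj, h3]
      push_cast
      ring
    rw [Finset.sum_congr rfl fun ω _ => hsum ω, Finset.prod_insert hi]
    have h2 : ∑ ω, F ω + ∑ ω, F (f ω) = 2 * ∑ ω, F ω := by
      rw [Equiv.sum_comp f F, two_mul]
    rw [← Finset.sum_add_distrib, Finset.sum_congr rfl fun ω _ => hflip ω, ← Finset.mul_sum,
      ← Finset.mul_sum, ih] at h2
    have := mul_left_cancel₀ two_ne_zero h2
    rw [← this]
    ring

/-- The Halász-type bound for signed sums. -/
lemma card_signed_sum_eq_le (a : ι → ZMod p) {e : ι → κ} {J : Finset ι} (he : Set.InjOn e J)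
    (y : ZMod p) :
    ((Finset.univ.filter fun ω : κ → Bool =>
      ∑ j ∈ J, (intSign (ω (e j)) : ZMod p) * a j = y).card : ℝ) ≤
      weightEnergy J a / p * Fintype.card (κ → Bool) := by
  have hp0 : (0 : ℝ) < p := by exact_mod_cast (Fact.out : p.Prime).pos
  rw [div_mul_eq_mul_div, le_div_iff₀ hp0]
  have key : (((Finset.univ.filter fun ω : κ → Bool =>
      ∑ j ∈ J, (intSign (ω (e j)) : ZMod p) * a j = y).card : ℝ) * p : ℂ) =
      ∑ t : ZMod p, ZMod.stdAddChar (-(t * y)) *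
        (Fintype.card (κ → Bool) * ∏ j ∈ J, ((ZMod.stdAddChar (t * a j)).re : ℂ)) := by
    simp_rw [← sum_stdAddChar_signed _ a J he, Finset.mul_sum, ← AddChar.map_add_eq_mul]
    rw [Finset.sum_comm]
    have : ∀ (ω : κ → Bool) (t : ZMod p),
        -(t * y) + t * ∑ j ∈ J, (intSign (ω (e j)) : ZMod p) * a j =
        t * (∑ j ∈ J, (intSign (ω (e j)) : ZMod p) * a j - y) := fun ω t => by ring
    simp_rw [← Finset.mul_sum, this, sum_stdAddChar_mul, sub_eq_zero]
    rw [← Finset.sum_filter, Finset.sum_const, nsmul_eq_mul]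
    push_cast
    rfl
  have h := congrArg norm key
  rw [← Complex.ofReal_natCast p, ← Complex.ofReal_mul, Complex.norm_real,
    Real.norm_of_nonneg (by positivity)] at h
  rw [h]
  refine (norm_sum_le _ _).trans ?_
  unfold weightEnergy
  rw [Finset.sum_mul]
  refine Finset.sum_le_sum fun t _ => ?_
  rw [norm_mul, AddChar.norm_apply, one_mul, norm_mul, Complex.norm_natCast, mul_comm, norm_prod]
  gcongr
  unfold charWeight
  rw [← Real.exp_nat_mul, show ((2 : ℕ) : ℝ) * -((∑ j ∈ J, sinSq (t * a j)) / 4) =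
    ∑ j ∈ J, -(sinSq (t * a j) / 2) by
      rw [Finset.sum_neg_distrib, ← Finset.sum_div]; push_cast; ring, Real.exp_sum]
  refine Finset.prod_le_prod (fun _ _ => norm_nonneg _) fun j _ => ?_
  rw [Complex.norm_real]
  exact abs_re_le_exp _

/-- For a symmetric sign matrix with independent entries on and above the diagonal, the rows
outside `J` can be treated as independent as far as the columns in `J` are concerned. -/
lemma card_kernel_le [Fintype ι] {key : ι → ι → κ}
    (hkey : ∀ i j i' j', key i j = key i' j' → i = i' ∧ j = j' ∨ i = j' ∧ j = i')
    (J : Finset ι) (a : ι → ZMod p) :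
    ((Finset.univ.filter fun ω : κ → Bool =>
      ∀ i, ∑ j, (intSign (ω (key i j)) : ZMod p) * a j = 0).card : ℝ) ≤
      (weightEnergy J a / p) ^ (Jᶜ).card * Fintype.card (κ → Bool) := by
  have hp0 : (0 : ℝ) < p := by exact_mod_cast (Fact.out : p.Prime).pos
  refine le_trans ?_ (card_forall_le_of_resample (Jᶜ) (fun i => J.image (key i))
    (E := fun i ω => ∑ j, (intSign (ω (key i j)) : ZMod p) * a j = 0)
    (div_nonneg (weightEnergy_nonneg J a) hp0.le) ?_ ?_)
  · exact_mod_cast Finset.card_le_card fun ω hω => by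
      simp only [Finset.mem_filter, Finset.mem_univ, true_and] at hω ⊢
      exact fun i _ => hω i
  · intro i hi ω
    rw [Finset.mem_compl] at hi
    have hinj : Set.InjOn (key i) J := by
      intro j hj j' hj' h
      rcases hkey _ _ _ _ h with h | h
      · exact h.2
      · exact h.2.trans h.1
    refine le_trans (le_of_eq ?_) (card_signed_sum_eq_le a hinj
      (-∑ j ∈ Jᶜ, (intSign (ω (key i j)) : ZMod p) * a j))
    congr 2
    ext r
    simp only [Finset.mem_filter, Finset.mem_univ, true_and]
    rw [eq_neg_iff_add_eq_zero, ← Finset.sum_add_sum_compl J]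
    have h1 : ∀ j ∈ J, ((J.image (key i)).piecewise r ω) (key i j) = r (key i j) := by
      intro j hj
      exact Finset.piecewise_eq_of_mem _ _ _ (Finset.mem_image_of_mem _ hj)
    have h2 : ∀ j ∈ Jᶜ, ((J.image (key i)).piecewise r ω) (key i j) = ω (key i j) := by
      intro j hj
      rw [Finset.mem_compl] at hj
      refine Finset.piecewise_eq_of_notMem _ _ _ fun h => ?_
      obtain ⟨j', hj', h⟩ := Finset.mem_image.1 h
      rcases hkey _ _ _ _ h with h | h
      · exact hj (h.2 ▸ hj')
      · exact hi (h.2 ▸ hj')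
    rw [Finset.sum_congr rfl fun j hj => by rw [h1 j hj],
      Finset.sum_congr (s₁ := Jᶜ) rfl fun j hj => by rw [h2 j hj]]
  · intro i hi i' hi' hne ω r
    rw [Finset.mem_compl] at hi hi'
    have h1 : ∀ j, ((J.image (key i)).piecewise r ω) (key i' j) = ω (key i' j) := by
      intro j
      refine Finset.piecewise_eq_of_notMem _ _ _ fun h => ?_
      obtain ⟨j', hj', h⟩ := Finset.mem_image.1 h
      rcases hkey _ _ _ _ h with h | h
      · exact hne h.1.symm
      · exact hi' (h.2 ▸ hj')
    simp_rw [h1]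

end SmallBall

section UnionBound

variable {p : ℕ} [Fact p.Prime] {ι κ : Type*} [Fintype ι] [DecidableEq ι] [Fintype κ]
  [DecidableEq κ]

/-- The vectors whose coordinates outside `J` lie in the large spectrum given by `J`. -/
def structuredVectors (p : ℕ) [Fact p.Prime] (J : Finset ι) : Finset (ι → ZMod p) :=
  Finset.univ.filter fun a => (∃ i ∈ J, a i ≠ 0) ∧ 2 ≤ weightMass J a ∧
    ∀ j ∉ J, a j ∈ largeSpectrum J a

lemma card_largeSpectrum_mul_le (hp : p ≠ 2) {J : Finset ι} {a : ι → ZMod p}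
    (ha : a ∈ structuredVectors p J) :
    ((largeSpectrum J a).card : ℝ) * (weightEnergy J a / p) ≤ 0.997 := by
  have hp0 : (0 : ℝ) < p := by exact_mod_cast (Fact.out : p.Prime).pos
  obtain ⟨⟨i, hi, hai⟩, hU, -⟩ := (Finset.mem_filter.1 ha).2
  have h1 := card_largeSpectrum_le hp J a
  have h2 := weightEnergy_le hp hi hai hU
  have h3 := weightEnergy_nonneg J a
  have hU2 : 0 < weightMass J a ^ 2 := by positivity
  rw [← mul_div_assoc, div_le_iff₀ hp0]
  refine le_of_mul_le_mul_right ?_ hU2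
  have h4 := mul_le_mul_of_nonneg_right h1 h3
  have h5 : weightEnergy J a ^ 2 ≤ (0.997 * weightMass J a) ^ 2 := by gcongr
  have h6 := mul_le_mul_of_nonneg_left h5 hp0.le
  have h7 : (0 : ℝ) ≤ p * weightMass J a ^ 2 := by positivity
  nlinarith

lemma sum_structuredVectors_le (hp : p ≠ 2) (J : Finset ι) :
    ∑ a ∈ structuredVectors p J, (weightEnergy J a / p) ^ (Jᶜ).card ≤
      (p : ℝ) ^ J.card * 0.997 ^ (Jᶜ).card := by
  have hp0 : (0 : ℝ) < p := by exact_mod_cast (Fact.out : p.Prime).pos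
  set T : Finset (ι → ZMod p) :=
    Fintype.piFinset fun i => if i ∈ J then Finset.univ else {0} with hT
  have hTcard : T.card = p ^ J.card := by
    rw [hT, Fintype.card_piFinset, ← Finset.prod_mul_prod_compl J,
      Finset.prod_congr (g := fun _ => p) rfl fun i hi => by simp [hi],
      Finset.prod_congr (s₁ := Jᶜ) (g := fun _ => 1) rfl fun i hi => by
        simp [Finset.mem_compl.1 hi]]
    simp
  set φ : (ι → ZMod p) → ι → ZMod p := fun a => J.piecewise a 0 with hφ
  have hmaps : ∀ a ∈ structuredVectors p J, φ a ∈ T := by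
    intro a _
    rw [hφ, hT, Fintype.mem_piFinset]
    intro i
    by_cases hi : i ∈ J <;> simp [hi]
  rw [← Finset.sum_fiberwise_of_maps_to hmaps]
  calc _ ≤ ∑ _b ∈ T, (0.997 : ℝ) ^ (Jᶜ).card := Finset.sum_le_sum fun b _ => ?_
    _ = _ := by rw [Finset.sum_const, hTcard, nsmul_eq_mul]; push_cast; rfl
  rcases Finset.eq_empty_or_nonempty
    ((structuredVectors p J).filter fun a => φ a = b) with h | ⟨c, hc⟩
  · rw [h, Finset.sum_empty]
    positivity
  obtain ⟨hc, hcb⟩ := Finset.mem_filter.1 hc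
  have hagree : ∀ a ∈ (structuredVectors p J).filter (fun a => φ a = b),
      ∀ j ∈ J, a j = c j := by
    intro a ha j hj
    have h := congrFun ((Finset.mem_filter.1 ha).2.trans hcb.symm) j
    simpa [hφ, hj] using h
  have hweight : ∀ a ∈ (structuredVectors p J).filter (fun a => φ a = b),
      charWeight J a = charWeight J c := fun a ha => charWeight_congr (hagree a ha)
  have hsub : (structuredVectors p J).filter (fun a => φ a = b) ⊆
      Fintype.piFinset fun i => if i ∈ J then {c i} else largeSpectrum J c := by
    intro a ha
    rw [Fintype.mem_piFinset]
    intro i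
    by_cases hi : i ∈ J
    · simpa [hi] using hagree a ha i hi
    · have h := (Finset.mem_filter.1 (Finset.mem_filter.1 ha).1).2.2.2 i hi
      unfold largeSpectrum weightMass at h ⊢
      rw [hweight a ha] at h
      simpa [hi] using h
  have hcard := Finset.card_le_card hsub
  rw [Fintype.card_piFinset, ← Finset.prod_mul_prod_compl J,
    Finset.prod_congr (g := fun _ => 1) rfl fun i hi => by simp [hi],
    Finset.prod_congr (s₁ := Jᶜ) (g := fun _ => (largeSpectrum J c).card) rfl fun i hi => by
      simp [Finset.mem_compl.1 hi], Finset.prod_const_one, one_mul, Finset.prod_const] at hcard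
  have hE := weightEnergy_nonneg J c
  rw [Finset.sum_congr (g := fun _ => (weightEnergy J c / p) ^ (Jᶜ).card) rfl fun a ha => by
    unfold weightEnergy; rw [hweight a ha], Finset.sum_const, nsmul_eq_mul]
  calc _ ≤ ((largeSpectrum J c).card : ℝ) ^ (Jᶜ).card * (weightEnergy J c / p) ^ (Jᶜ).card := by
        gcongr
        exact_mod_cast hcard
    _ = (((largeSpectrum J c).card : ℝ) * (weightEnergy J c / p)) ^ (Jᶜ).card :=
        (mul_pow ..).symm
    _ ≤ _ := by
        gcongr
        exact card_largeSpectrum_mul_le hp hc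

omit [Fintype ι] in
lemma exists_image_eq {J : Finset ι} (hJ : J.Nonempty) {d : ℕ} (hd : J.card ≤ d) :
    ∃ f : Fin d → ι, Finset.univ.image f = J := by
  have : Nonempty J := hJ.to_subtype
  obtain ⟨g⟩ := Function.Embedding.nonempty_of_card_le (α := J) (β := Fin d) (by simpa using hd)
  have hg := Function.invFun_surjective g.injective
  refine ⟨fun i => (Function.invFun g i : J), ?_⟩
  ext x
  simp only [Finset.mem_image, Finset.mem_univ, true_and]
  constructor
  · rintro ⟨i, rfl⟩
    exact (Function.invFun g i).2
  · intro hx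
    obtain ⟨i, hi⟩ := hg ⟨x, hx⟩
    exact ⟨i, by rw [hi]⟩

lemma card_filter_card_le (d : ℕ) :
    (Finset.univ.filter fun J : Finset ι => J.Nonempty ∧ J.card ≤ d).card ≤
      Fintype.card ι ^ d := by
  calc _ ≤ (Finset.univ.image fun f : Fin d → ι => Finset.univ.image f).card := by
        refine Finset.card_le_card fun J hJ => ?_
        obtain ⟨h1, h2⟩ := (Finset.mem_filter.1 hJ).2
        obtain ⟨f, hf⟩ := exists_image_eq h1 h2
        exact Finset.mem_image.2 ⟨f, Finset.mem_univ _, hf⟩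
    _ ≤ (Finset.univ : Finset (Fin d → ι)).card := Finset.card_image_le
    _ = _ := by simp

/-- With exponentially small failure probability, a symmetric sign matrix has no nonzero kernel
vector modulo `p` whose signed sums are concentrated. -/
lemma card_concentrated_kernel_le (hp : p ≠ 2) {key : ι → ι → κ}
    (hkey : ∀ i j i' j', key i j = key i' j' → i = i' ∧ j = j' ∨ i = j' ∧ j = i') {d : ℕ}
    (hd : ∀ s : ℕ, (16000 / 15999 : ℝ) ^ s ≤ 16000 / 15999 * p → s ≤ d) :
    ((Finset.univ.filter fun ω : κ → Bool => ∃ a : ι → ZMod p, a ≠ 0 ∧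
      2 ≤ weightMass Finset.univ a ∧
        ∀ i, ∑ j, (intSign (ω (key i j)) : ZMod p) * a j = 0).card : ℝ) ≤
      (2 * Fintype.card ι * p) ^ d * 0.997 ^ Fintype.card ι * Fintype.card (κ → Bool) := by
  have hp1 : (1 : ℝ) ≤ p := by exact_mod_cast (Fact.out : p.Prime).one_le
  set N := fun a : ι → ZMod p => Finset.univ.filter fun ω : κ → Bool =>
    ∀ i, ∑ j, (intSign (ω (key i j)) : ZMod p) * a j = 0 with hN
  set F := Finset.univ.filter fun J : Finset ι => J.Nonempty ∧ J.card ≤ d with hF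
  have hsub : (Finset.univ.filter fun ω : κ → Bool => ∃ a : ι → ZMod p, a ≠ 0 ∧
      2 ≤ weightMass Finset.univ a ∧
        ∀ i, ∑ j, (intSign (ω (key i j)) : ZMod p) * a j = 0) ⊆
      F.biUnion fun J => (structuredVectors p J).biUnion N := by
    intro ω hω
    obtain ⟨a, ha, hU, hker⟩ := (Finset.mem_filter.1 hω).2
    obtain ⟨i, hi⟩ := Function.ne_iff.1 ha
    obtain ⟨J, hiJ, hJ, hspec⟩ := exists_core a i
    refine Finset.mem_biUnion.2 ⟨J, Finset.mem_filter.2 ⟨Finset.mem_univ _, ⟨i, hiJ⟩, hd _ hJ⟩,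
      Finset.mem_biUnion.2 ⟨a, Finset.mem_filter.2 ⟨Finset.mem_univ _, ⟨i, hiJ, hi⟩, ?_, hspec⟩,
        Finset.mem_filter.2 ⟨Finset.mem_univ _, hker⟩⟩⟩
    exact hU.trans (weightMass_anti (Finset.subset_univ _) a)
  have hJ : ∀ J ∈ F, (((structuredVectors p J).biUnion N).card : ℝ) ≤
      (2 * p) ^ d * 0.997 ^ Fintype.card ι * Fintype.card (κ → Bool) := by
    intro J hJ
    have hJd := (Finset.mem_filter.1 hJ).2.2
    calc (((structuredVectors p J).biUnion N).card : ℝ)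
        ≤ ∑ a ∈ structuredVectors p J, ((N a).card : ℝ) := by
          exact_mod_cast Finset.card_biUnion_le
      _ ≤ ∑ a ∈ structuredVectors p J,
          (weightEnergy J a / p) ^ (Jᶜ).card * Fintype.card (κ → Bool) :=
          Finset.sum_le_sum fun a _ => card_kernel_le hkey J a
      _ ≤ (p : ℝ) ^ J.card * 0.997 ^ (Jᶜ).card * Fintype.card (κ → Bool) := by
          rw [← Finset.sum_mul]
          gcongr
          exact sum_structuredVectors_le hp J
      _ ≤ _ := by
          have h1 : (1 : ℝ) ≤ 2 ^ d * 0.997 ^ J.card :=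
            calc (1 : ℝ) ≤ (2 * 0.997) ^ J.card := one_le_pow₀ (by norm_num)
              _ = 2 ^ J.card * 0.997 ^ J.card := mul_pow ..
              _ ≤ _ := by gcongr; norm_num
          refine mul_le_mul_of_nonneg_right ?_ (by positivity)
          calc (p : ℝ) ^ J.card * 0.997 ^ (Jᶜ).card
              ≤ (p : ℝ) ^ d * (2 ^ d * 0.997 ^ J.card * 0.997 ^ (Jᶜ).card) :=
                mul_le_mul (pow_le_pow_right₀ hp1 hJd)
                  (le_mul_of_one_le_left (by positivity) h1) (by positivity) (by positivity)
            _ = _ := by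
                rw [mul_pow, ← Finset.card_add_card_compl J, pow_add]
                ring
  calc _ ≤ ((F.biUnion fun J => (structuredVectors p J).biUnion N).card : ℝ) := by
        exact_mod_cast Finset.card_le_card hsub
    _ ≤ ∑ J ∈ F, (((structuredVectors p J).biUnion N).card : ℝ) := by
        exact_mod_cast Finset.card_biUnion_le
    _ ≤ ∑ _J ∈ F, (2 * p : ℝ) ^ d * 0.997 ^ Fintype.card ι * Fintype.card (κ → Bool) :=
        Finset.sum_le_sum hJ
    _ = F.card * ((2 * p : ℝ) ^ d * 0.997 ^ Fintype.card ι * Fintype.card (κ → Bool)) := by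
        rw [Finset.sum_const, nsmul_eq_mul]
    _ ≤ (Fintype.card ι : ℝ) ^ d *
        ((2 * p : ℝ) ^ d * 0.997 ^ Fintype.card ι * Fintype.card (κ → Bool)) := by
        gcongr
        exact_mod_cast card_filter_card_le d
    _ = _ := by rw [mul_pow, mul_pow, mul_pow]; ring

/-- Singularity estimate for a kernel vector `a` determined by the coordinates `key i j` of the
configuration, tested against a further row read off from independent coordinates. -/
lemma card_selected_kernel_le (hp : p ≠ 2) {key : ι → ι → κ}
    (hkey : ∀ i j i' j', key i j = key i' j' → i = i' ∧ j = j' ∨ i = j' ∧ j = i') {d : ℕ}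
    (hd : ∀ s : ℕ, (16000 / 15999 : ℝ) ^ s ≤ 16000 / 15999 * p → s ≤ d) {row : ι → κ}
    (hrow : row.Injective) (hrk : ∀ i j k, key i j ≠ row k) (a : (κ → Bool) → ι → ZMod p)
    (ha : ∀ ω ω', (∀ i j, ω (key i j) = ω' (key i j)) → a ω = a ω')
    {E : (κ → Bool) → Prop} [DecidablePred E]
    (hE : ∀ ω, E ω → a ω ≠ 0 ∧
      (∀ i, ∑ j, (intSign (ω (key i j)) : ZMod p) * a ω j = 0) ∧
        ∑ j, (intSign (ω (row j)) : ZMod p) * a ω j = 0) :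
    ((Finset.univ.filter fun ω : κ → Bool => E ω).card : ℝ) ≤
      ((2 * Fintype.card ι * p) ^ d * 0.997 ^ Fintype.card ι + 2 / p) *
        Fintype.card (κ → Bool) := by
  set B : Finset κ := Finset.univ.image row with hB
  have haB : ∀ ω r, a (B.piecewise r ω) = a ω := fun ω r => ha _ _ fun i j =>
    Finset.piecewise_eq_of_notMem _ _ _ fun h => by
      obtain ⟨k, -, hk⟩ := Finset.mem_image.1 h
      exact hrk i j k hk.symm
  have hgood : ((Finset.univ.filter fun ω : κ → Bool =>
      ∑ j, (intSign (ω (row j)) : ZMod p) * a ω j = 0 ∧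
        weightMass Finset.univ (a ω) < 2).card : ℝ) ≤
      2 / p * (Finset.univ.filter fun ω => weightMass Finset.univ (a ω) < 2).card := by
    refine card_and_le_of_resample B (fun ω hω => ?_) fun ω r => by rw [haB]
    refine le_trans (le_trans (le_of_eq ?_)
      (card_signed_sum_eq_le (J := Finset.univ) (a ω) hrow.injOn 0)) ?_
    · congr 2
      ext r
      simp only [Finset.mem_filter, Finset.mem_univ, true_and, haB]
      refine Eq.congr (Finset.sum_congr rfl fun j _ => ?_) rfl
      rw [Finset.piecewise_eq_of_mem _ _ _ (Finset.mem_image_of_mem _ (Finset.mem_univ j))]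
    · gcongr
      exact (weightEnergy_le_weightMass _ _).trans hω.le
  have hRle : ((Finset.univ.filter fun ω => weightMass Finset.univ (a ω) < 2).card : ℝ) ≤
      Fintype.card (κ → Bool) := Nat.cast_le.2 (Finset.card_le_univ _)
  have hcard : ((Finset.univ.filter fun ω : κ → Bool => E ω).card : ℝ) ≤
      (Finset.univ.filter fun ω : κ → Bool => ∃ a : ι → ZMod p, a ≠ 0 ∧
        2 ≤ weightMass Finset.univ a ∧
          ∀ i, ∑ j, (intSign (ω (key i j)) : ZMod p) * a j = 0).card +
      (Finset.univ.filter fun ω : κ → Bool =>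
        ∑ j, (intSign (ω (row j)) : ZMod p) * a ω j = 0 ∧
          weightMass Finset.univ (a ω) < 2).card := by
    rw [← Nat.cast_add]
    refine Nat.cast_le.2 ((Finset.card_le_card fun ω hω => ?_).trans (Finset.card_union_le _ _))
    simp only [Finset.mem_filter, Finset.mem_union, Finset.mem_univ, true_and] at hω ⊢
    obtain ⟨hne, hker, hsum⟩ := hE ω hω
    rcases le_or_gt 2 (weightMass Finset.univ (a ω)) with h | h
    · exact Or.inl ⟨a ω, hne, h, hker⟩
    · exact Or.inr ⟨hsum, h⟩
  have hbad := card_concentrated_kernel_le hp hkey hd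
  have h2 := mul_le_mul_of_nonneg_left hRle (show 0 ≤ 2 / (p : ℝ) by positivity)
  linarith

end UnionBound

section Numerics

lemma exists_log_sq_le (A : ℝ) {c : ℝ} (hA : 0 < A) (hc : 0 < c) :
    ∃ D : ℝ, ∀ n : ℕ, 1 ≤ n → A * Real.log n ^ 2 ≤ c * n + D := by
  have h := (Real.isLittleO_pow_log_id_atTop (n := 2)).bound (div_pos hc hA)
  obtain ⟨X, hX⟩ := Filter.eventually_atTop.1 h
  refine ⟨A * Real.log (max X 1) ^ 2, fun n hn => ?_⟩
  have hn1 : (1 : ℝ) ≤ n := by exact_mod_cast hn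
  rcases le_total X n with hXn | hXn
  · have h1 := hX n hXn
    simp only [id, norm_pow, Real.norm_eq_abs, sq_abs] at h1
    rw [abs_of_nonneg (by positivity), div_mul_eq_mul_div, le_div_iff₀ hA] at h1
    have : 0 ≤ A * Real.log (max X 1) ^ 2 := by positivity
    linarith
  · have h1 : Real.log n ≤ Real.log (max X 1) :=
      Real.log_le_log (by linarith) (hXn.trans (le_max_left _ _))
    have h2 := Real.log_nonneg hn1
    have : A * Real.log n ^ 2 ≤ A * Real.log (max X 1) ^ 2 := by gcongr
    have : 0 ≤ c * n := by positivity
    linarith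

lemma exists_prime_and_bound {C : ℝ} (hC : 0 < C) :
    ∃ K : ℝ, 0 < K ∧ ∀ m : ℕ, 1 ≤ m → ∃ p d : ℕ, p.Prime ∧ p ≠ 2 ∧
      (∀ s : ℕ, (16000 / 15999 : ℝ) ^ s ≤ 16000 / 15999 * p → s ≤ d) ∧
      (2 * m * p : ℝ) ^ d * 0.997 ^ m + 2 / p ≤ K * ((m + 1 : ℕ) : ℝ) ^ (-C) := by
  set l : ℝ := 16000 / 15999 with hl
  have hl1 : 1 < l := by norm_num [hl]
  have hl2 : l ≤ 2 := by norm_num [hl]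
  have hlog : 0 < Real.log l := Real.log_pos hl1
  set k : ℕ := ⌈C⌉₊ + 1 with hk
  have hkC : C ≤ k := by
    rw [hk]
    push_cast
    linarith [Nat.le_ceil C]
  set A : ℝ := (k + 2) * (k + 3) / Real.log l with hA
  set c : ℝ := -Real.log 0.997 with hc
  have hc0 : 0 < c := neg_pos.2 (Real.log_neg (by norm_num) (by norm_num))
  obtain ⟨D, hD⟩ := exists_log_sq_le (A + 2 * C) (c := c) (by positivity) hc0
  refine ⟨2 * Real.exp D + 2, by positivity, fun m hm => ?_⟩
  set n : ℕ := m + 1 with hn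
  have hn2 : 2 ≤ n := by omega
  have hn2' : (2 : ℝ) ≤ n := by exact_mod_cast hn2
  have hn0 : (0 : ℝ) < n := by linarith
  set L := Real.log n with hL
  have hL2 : Real.log 2 ≤ L := Real.log_le_log (by norm_num) hn2'
  have hL1 : 1 ≤ 2 * L := by linarith [Real.log_two_gt_d9]
  have hk1 : n ≤ n ^ k := Nat.le_self_pow (by omega) n
  obtain ⟨p, hp, hnp, hpn⟩ := Nat.exists_prime_lt_and_le_two_mul (n ^ k) (by positivity)
  have hp0 : (0 : ℝ) < p := by exact_mod_cast hp.pos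
  have hpn' : (p : ℝ) ≤ 2 * (n : ℝ) ^ k := by exact_mod_cast hpn
  have hnp' : (n : ℝ) ^ k ≤ p := by exact_mod_cast hnp.le
  have hlogp : Real.log (l * p) ≤ (k + 2) * L := by
    calc Real.log (l * p) ≤ Real.log (2 * (2 * (n : ℝ) ^ k)) :=
          Real.log_le_log (by positivity) (by gcongr)
      _ = 2 * Real.log 2 + k * L := by
          rw [Real.log_mul (by norm_num) (by positivity),
            Real.log_mul (by norm_num) (by positivity), Real.log_pow]
          ring
      _ ≤ _ := by linarith
  have hlogp0 : 0 ≤ Real.log (l * p) := by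
    apply Real.log_nonneg
    have : (1 : ℝ) ≤ p := by exact_mod_cast hp.one_le
    nlinarith
  set d : ℕ := ⌊Real.log (l * p) / Real.log l⌋₊ with hd
  have hd1 : (d : ℝ) ≤ (k + 2) * L / Real.log l :=
    (Nat.floor_le (by positivity)).trans (by gcongr)
  refine ⟨p, d, hp, by omega, fun s hs => ?_, ?_⟩
  · refine Nat.le_floor ?_
    rw [le_div_iff₀ hlog, ← Real.log_pow]
    exact Real.log_le_log (by positivity) hs
  have hsecond : 2 / (p : ℝ) ≤ 2 * (n : ℝ) ^ (-C) := by
    rw [Real.rpow_neg hn0.le, div_eq_mul_inv]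
    gcongr
    calc (n : ℝ) ^ C ≤ (n : ℝ) ^ (k : ℝ) := Real.rpow_le_rpow_of_exponent_le (by linarith) hkC
      _ = (n : ℝ) ^ k := Real.rpow_natCast _ _
      _ ≤ p := hnp'
  have hbase : Real.log (2 * m * p) ≤ (k + 3) * L := by
    have hmn : (m : ℝ) ≤ n := by exact_mod_cast Nat.le_succ m
    have hm0 : (0 : ℝ) < m := by exact_mod_cast hm
    calc Real.log (2 * m * p) ≤ Real.log (2 * n * (2 * (n : ℝ) ^ k)) :=
          Real.log_le_log (by positivity) (by gcongr)
      _ = 2 * Real.log 2 + (k + 1) * L := by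
          rw [Real.log_mul (by positivity) (by positivity),
            Real.log_mul (by norm_num) (by positivity),
            Real.log_mul (by norm_num) (by positivity), Real.log_pow]
          ring
      _ ≤ _ := by linarith
  have hm0 : (0 : ℝ) < m := by exact_mod_cast hm
  have hfirst : (2 * m * p : ℝ) ^ d ≤ Real.exp (A * L ^ 2) := by
    rw [← Real.exp_log (show (0 : ℝ) < 2 * m * p by positivity), ← Real.exp_nat_mul,
      Real.exp_le_exp]
    calc (d : ℝ) * Real.log (2 * m * p) ≤ d * ((k + 3) * L) := by gcongr
      _ ≤ (k + 2) * L / Real.log l * ((k + 3) * L) := by gcongr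
      _ = _ := by rw [hA]; ring
  have hpow : (0.997 : ℝ) ^ m ≤ 2 * Real.exp (-(c * n)) := by
    have h1 : Real.exp (-(c * n)) = 0.997 ^ n := by
      rw [hc, neg_mul, neg_neg, mul_comm, Real.exp_nat_mul, Real.exp_log (by norm_num)]
    rw [h1, hn, pow_succ]
    have : (0 : ℝ) ≤ 0.997 ^ m := by positivity
    linarith
  have hexp : Real.exp (A * L ^ 2) * Real.exp (-(c * n)) ≤ Real.exp D * (n : ℝ) ^ (-C) := by
    rw [Real.rpow_def_of_pos hn0, ← Real.exp_add, ← Real.exp_add, Real.exp_le_exp]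
    have h1 := hD n (by omega)
    have h2 : C * L ≤ 2 * C * L ^ 2 := by
      have : 0 ≤ C * L := by positivity
      nlinarith
    rw [← hL] at h1 ⊢
    nlinarith
  calc (2 * m * p : ℝ) ^ d * 0.997 ^ m + 2 / p
      ≤ Real.exp (A * L ^ 2) * (2 * Real.exp (-(c * n))) + 2 * (n : ℝ) ^ (-C) := by gcongr
    _ ≤ _ := by nlinarith

end Numerics

section KernelVector

/-- The integer kernel vector of a symmetric matrix of corank one annihilates the bordering row
of every singular symmetric one-step extension. -/
lemma exists_primitive_kernel_vector {m : ℕ} (hm : 1 ≤ m) (N : Matrix (Fin m) (Fin m) ℤ)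
    (hrank : (N.map (Int.cast : ℤ → ℝ)).rank = m - 1) :
    ∃ v : Fin m → ℤ, (∀ p : ℕ, p.Prime → ∃ j, (v j : ZMod p) ≠ 0) ∧
      (∀ i, ∑ j, N i j * v j = 0) ∧
      ∀ A : Matrix (Fin (m + 1)) (Fin (m + 1)) ℤ, A.IsSymm →
        (∀ i j : Fin m, A i.succ j.succ = N i j) → A.det = 0 →
        ∑ j : Fin m, A 0 j.succ * v j = 0 := by
  have hdet : N.det = 0 := by
    by_contra h
    have h1 : IsUnit (N.map (Int.cast : ℤ → ℝ)) := by
      rw [Matrix.isUnit_iff_isUnit_det, isUnit_iff_ne_zero]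
      have : (N.map (Int.cast : ℤ → ℝ)).det = ((N.det : ℤ) : ℝ) :=
        (RingHom.map_det (Int.castRingHom ℝ) N).symm
      rw [this]
      exact_mod_cast h
    have h2 := Matrix.rank_of_isUnit _ h1
    rw [hrank, Fintype.card_fin] at h2
    omega
  obtain ⟨v₀, hv₀, hNv₀⟩ := Matrix.exists_mulVec_eq_zero_iff.2 hdet
  obtain ⟨v, hv, hgcd⟩ := Finset.extract_gcd v₀ (s := Finset.univ) ⟨⟨0, hm⟩, Finset.mem_univ _⟩
  set g := Finset.univ.gcd v₀ with hg
  have hg0 : g ≠ 0 := by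
    intro h
    apply hv₀
    funext j
    rw [hv j (Finset.mem_univ _), h, zero_mul]
    rfl
  have hker : ∀ i, ∑ j, N i j * v j = 0 := by
    intro i
    have h := congrFun hNv₀ i
    simp only [Matrix.mulVec, dotProduct, Pi.zero_apply] at h
    have h1 : ∑ j, N i j * v₀ j = g * ∑ j, N i j * v j := by
      rw [Finset.mul_sum]
      exact Finset.sum_congr rfl fun j _ => by rw [hv j (Finset.mem_univ _)]; ring
    rw [h1] at h
    exact (mul_eq_zero.1 h).resolve_left hg0
  refine ⟨v, fun p hp => ?_, hker, fun A hA hAN hdetA => ?_⟩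
  · by_contra! h
    have h1 : (p : ℤ) ∣ Finset.univ.gcd v :=
      Finset.dvd_gcd fun j _ => (ZMod.intCast_zmod_eq_zero_iff_dvd _ _).1 (h j)
    rw [hgcd] at h1
    exact hp.one_lt.ne' (by exact_mod_cast Int.eq_one_of_dvd_one (by positivity) h1)
  obtain ⟨w, hw, hAw⟩ := Matrix.exists_mulVec_eq_zero_iff.2 hdetA
  have hrow : ∀ i, A i 0 * w 0 + ∑ j : Fin m, A i j.succ * w j.succ = 0 := by
    intro i
    have h := congrFun hAw i
    simpa only [Matrix.mulVec, dotProduct, Pi.zero_apply, Fin.sum_univ_succ] using h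
  have hN : N.IsSymm := by
    ext i j
    rw [Matrix.transpose_apply, ← hAN, ← hAN]
    exact hA.apply _ _
  by_cases hw0 : w 0 = 0
  · have hv_ne : (fun j => (v j : ℝ)) ≠ 0 := by
      intro h
      apply hv₀
      funext j
      have h1 : (v j : ℝ) = 0 := congrFun h j
      have h2 : v j = 0 := by exact_mod_cast h1
      rw [hv j (Finset.mem_univ _), h2, mul_zero]
      rfl
    set T := (N.map (Int.cast : ℤ → ℝ)).mulVecLin with hT
    have hmem : ∀ u : Fin m → ℤ, (∀ i, ∑ j, N i j * u j = 0) →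
        (fun j => (u j : ℝ)) ∈ LinearMap.ker T := by
      intro u hu
      rw [LinearMap.mem_ker]
      funext i
      have h := congrArg (Int.cast : ℤ → ℝ) (hu i)
      push_cast at h
      simpa [hT, Matrix.mulVec, dotProduct] using h
    have hfin : Module.finrank ℝ (LinearMap.ker T) = 1 := by
      have h1 := LinearMap.finrank_range_add_finrank_ker T
      have h2 : Module.finrank ℝ (LinearMap.range T) = m - 1 := hrank
      rw [h2, Module.finrank_fin_fun] at h1
      omega
    have hw' : ∀ i, ∑ j, N i j * w j.succ = 0 := by
      intro i
      have h := hrow i.succ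
      simpa only [hw0, mul_zero, zero_add, hAN] using h
    obtain ⟨c, hc⟩ := (finrank_eq_one_iff_of_nonzero'
      (⟨_, hmem v hker⟩ : LinearMap.ker T) (by simpa using hv_ne)).1 hfin ⟨_, hmem _ hw'⟩
    have hc' : ∀ j : Fin m, c * (v j : ℝ) = w j.succ := fun j => congrFun (congrArg Subtype.val hc) j
    have hc0 : c ≠ 0 := by
      rintro rfl
      apply hw
      funext j
      refine Fin.cases hw0 (fun j => ?_) j
      have h := hc' j
      rw [zero_mul] at h
      exact_mod_cast h.symm
    have h := congrArg (Int.cast : ℤ → ℝ) (hrow 0)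
    rw [hw0, mul_zero, zero_add] at h
    push_cast at h
    simp_rw [← hc', mul_left_comm _ c] at h
    rw [← Finset.mul_sum] at h
    exact_mod_cast (mul_eq_zero.1 h).resolve_left hc0
  · refine (mul_eq_zero.1 ?_).resolve_left hw0
    have h1 : ∑ i, v i * (A i.succ 0 * w 0 + ∑ j : Fin m, A i.succ j.succ * w j.succ) = 0 :=
      Finset.sum_eq_zero fun i _ => by rw [hrow, mul_zero]
    have h2 : ∑ i, v i * ∑ j : Fin m, A i.succ j.succ * w j.succ = 0 := by
      simp_rw [Finset.mul_sum]
      rw [Finset.sum_comm]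
      refine Finset.sum_eq_zero fun j _ => ?_
      have h3 : ∑ i, v i * (A i.succ j.succ * w j.succ) = w j.succ * ∑ i, N j i * v i := by
        rw [Finset.mul_sum]
        refine Finset.sum_congr rfl fun i _ => ?_
        rw [hAN, ← hN.apply i j]
        ring
      rw [h3, hker, mul_zero]
    simp_rw [mul_add] at h1
    rw [Finset.sum_add_distrib, h2, add_zero] at h1
    rw [Finset.mul_sum, ← h1]
    refine Finset.sum_congr rfl fun i _ => ?_
    rw [← hA.apply 0 i.succ]
    ring

end KernelVector

section SignMatrix

/-- The integer symmetric sign matrix read off from a sign configuration. -/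
def intSymMat (n : ℕ) (ω : Fin n × Fin n → Bool) : Matrix (Fin n) (Fin n) ℤ :=
  Matrix.of fun i j => intSign (ω (min i j, max i j))

lemma intSymMat_isSymm (n : ℕ) (ω : Fin n × Fin n → Bool) : (intSymMat n ω).IsSymm := by
  ext i j
  simp [intSymMat, min_comm, max_comm]

lemma symMat_eq_map_intSymMat (n : ℕ) (g : Fin n → Fin n → Bool) :
    symMat n g = (intSymMat n fun x => g x.1 x.2).map (Int.cast : ℤ → ℝ) := by
  have h : ∀ b, signv b = (intSign b : ℝ) := fun b => by cases b <;> simp [signv, intSign]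
  ext i j
  by_cases hij : i ≤ j
  · simp [symMat, intSymMat, hij, h]
  · simp [symMat, intSymMat, hij, h, (not_le.1 hij).le]

/-- The coordinate carrying the `(i, j)` entry of the lower right principal submatrix. -/
def tailKey (m : ℕ) (i j : Fin m) : Fin (m + 1) × Fin (m + 1) :=
  (min i.succ j.succ, max i.succ j.succ)

lemma tailKey_eq {m : ℕ} (i j i' j' : Fin m) (h : tailKey m i j = tailKey m i' j') :
    i = i' ∧ j = j' ∨ i = j' ∧ j = i' := by
  simp only [tailKey, Prod.mk.injEq, Fin.ext_iff, Fin.coe_min, Fin.coe_max, Fin.val_succ] at h ⊢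
  omega

lemma tailKey_fst_ne_zero {m : ℕ} (i j : Fin m) : (tailKey m i j).1 ≠ 0 := by
  simp only [tailKey, ne_eq, Fin.ext_iff, Fin.coe_min, Fin.val_succ, Fin.val_zero]
  omega

/-- The lower right principal submatrix of codimension one. -/
def tailMat (m : ℕ) (ω : Fin (m + 1) × Fin (m + 1) → Bool) : Matrix (Fin m) (Fin m) ℤ :=
  Matrix.of fun i j => intSign (ω (tailKey m i j))

lemma card_singular_tail_corank_one_le {m p d : ℕ} (hm : 1 ≤ m) (hp : p.Prime) (hp2 : p ≠ 2)
    (hd : ∀ s : ℕ, (16000 / 15999 : ℝ) ^ s ≤ 16000 / 15999 * p → s ≤ d) :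
    ((Finset.univ.filter fun ω : Fin (m + 1) × Fin (m + 1) → Bool =>
      (intSymMat (m + 1) ω).det = 0 ∧
        ((tailMat m ω).map (Int.cast : ℤ → ℝ)).rank = m - 1).card : ℝ) ≤
      ((2 * m * p : ℝ) ^ d * 0.997 ^ m + 2 / p) *
        Fintype.card (Fin (m + 1) × Fin (m + 1) → Bool) := by
  have : Fact p.Prime := ⟨hp⟩
  choose V hV using exists_primitive_kernel_vector hm
  set a : Matrix (Fin m) (Fin m) ℤ → Fin m → ZMod p := fun N j =>
    if h : (N.map (Int.cast : ℤ → ℝ)).rank = m - 1 then (V N h j : ZMod p) else 0 with ha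
  refine le_trans (card_selected_kernel_le hp2 (tailKey_eq (m := m)) hd
    (row := fun j : Fin m => ((0 : Fin (m + 1)), j.succ))
    (fun j k h => Fin.succ_injective _ (congrArg Prod.snd h))
    (fun i j k h => tailKey_fst_ne_zero i j (congrArg Prod.fst h))
    (fun ω => a (tailMat m ω))
    (fun ω ω' h => congrArg a (Matrix.ext fun i j => congrArg intSign (h i j)))
    fun ω hω => ?_) (by rw [Fintype.card_fin])
  obtain ⟨hdet, hrank⟩ := hω
  obtain ⟨hne, hker, hborder⟩ := hV (tailMat m ω) hrank
  have haω : a (tailMat m ω) = fun j => (V (tailMat m ω) hrank j : ZMod p) := by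
    funext j
    simp only [ha]
    rw [dif_pos hrank]
  rw [haω]
  refine ⟨?_, fun i => ?_, ?_⟩
  · obtain ⟨j, hj⟩ := hne p hp
    exact fun h => hj (congrFun h j)
  · have h := congrArg (Int.cast : ℤ → ZMod p) (hker i)
    push_cast at h
    exact h
  · have h := congrArg (Int.cast : ℤ → ZMod p)
      (hborder (intSymMat (m + 1) ω) (intSymMat_isSymm _ ω) (fun i j => rfl) hdet)
    push_cast at h
    simpa [intSymMat] using h

lemma probSym_le_of_card_le {n : ℕ} {P : Matrix (Fin n) (Fin n) ℝ → Prop}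
    {Q : (Fin n × Fin n → Bool) → Prop} [DecidablePred Q] {q : ℝ}
    (hPQ : ∀ g, P (symMat n g) → Q fun x => g x.1 x.2)
    (hQ : ((Finset.univ.filter fun ω => Q ω).card : ℝ) ≤
      q * Fintype.card (Fin n × Fin n → Bool)) :
    probSym n P ≤ q := by
  have hcard : Fintype.card (Fin n → Fin n → Bool) = Fintype.card (Fin n × Fin n → Bool) :=
    Fintype.card_congr (Equiv.curry (Fin n) (Fin n) Bool).symm
  have hc : (0 : ℝ) < Fintype.card (Fin n → Fin n → Bool) := Nat.cast_pos.2 Fintype.card_pos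
  have hle : (Finset.univ.filter fun g : Fin n → Fin n → Bool => P (symMat n g)).card ≤
      (Finset.univ.filter fun ω => Q ω).card :=
    Finset.card_le_card_of_injOn (Equiv.curry (Fin n) (Fin n) Bool).symm
      (fun g hg => Finset.mem_filter.2 ⟨Finset.mem_univ _, hPQ g (Finset.mem_filter.1 hg).2⟩)
      (Equiv.injective _).injOn
  unfold probSym
  rw [div_le_iff₀ hc, hcard]
  exact (Nat.cast_le.2 hle).trans hQ

end SignMatrix

/-- For every `C > 0` there is `K > 0` such that for all `n ≥ 2`,
`P(det(M_n) = 0 ∧ rank(M_{n-1}) = n - 2) ≤ K · n^{-C}`, where `M_{n-1}` is the principal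
submatrix of `M_n` obtained by deleting the first row and the first column. -/
theorem singularity_case_degenerate :
    ∀ C : ℝ, 0 < C → ∃ K : ℝ, 0 < K ∧ ∀ n : ℕ, ∀ hn : 2 ≤ n,
      probSym n (fun M => M.det = 0 ∧
          (M.submatrix (fun i : Fin (n - 1) => Fin.cast (by omega) i.succ)
            (fun i : Fin (n - 1) => Fin.cast (by omega) i.succ)).rank = n - 2) ≤
        K * (n : ℝ) ^ (-C) := by
  intro C hC
  obtain ⟨K, hK, hbound⟩ := exists_prime_and_bound hC
  refine ⟨K, hK, fun n hn => ?_⟩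
  obtain ⟨m, rfl⟩ : ∃ m, n = m + 1 := ⟨n - 1, by omega⟩
  have hm : 1 ≤ m := by omega
  obtain ⟨p, d, hp, hp2, hd, hle⟩ := hbound m hm
  refine (probSym_le_of_card_le (fun g hg => ?_)
    (card_singular_tail_corank_one_le hm hp hp2 hd)).trans hle
  obtain ⟨hdet, hrank⟩ := hg
  rw [symMat_eq_map_intSymMat] at hdet hrank
  refine ⟨?_, hrank⟩
  have h : ((intSymMat (m + 1) fun x => g x.1 x.2).map (Int.cast : ℤ → ℝ)).det =
      ((intSymMat (m + 1) fun x => g x.1 x.2).det : ℝ) :=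
    (RingHom.map_det (Int.castRingHom ℝ) _).symm
  rw [h] at hdet
  exact_mod_cast hdet

end
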